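/- arXiv:2512.19303 — 2 statements merged into one kernel-verified Lean document; each statement's English description precedes it below -/
import Mathlib

section
/- (Proposition 3.4, part 2.) Let n ≥ 1, let M ⊆ ℝⁿ be open, and let V : M → Sym(n, ℝ) be a continuously differentiable map into the invertible real symmetric n×n matrices satisfying the symmetry condition: for all m ∈ M and Δ, Δ₁ ∈ ℝⁿ, (D_{V(m)Δ}V)(m)·Δ₁ = (D_{V(m)Δ₁}V)(m)·Δ. Let g = [[A, b], [cᵀ, d]] be an invertible real (n+1)×(n+1) matrix and let U ⊆ ℝⁿ be an open set such that cᵀm + d > 0 and h_g(m) ∈ M for all m ∈ U. Then W := T_g(V) : U → Sym(n, ℝ) takes invertible values, is continuously differentiable, and satisfies the same symmetry condition: for all m ∈ U and Δ, Δ₁ ∈ ℝⁿ, (D_{W(m)Δ}W)(m)·Δ₁ = (D_{W(m)Δ₁}W)(m)·Δ. -/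
open Matrix

attribute [local instance] Matrix.normedAddCommGroup Matrix.normedSpace

/-- The homography `h_g(x) = (Ax + b)/(cᵀx + d)` associated to the block matrix
`g = [[A, b], [cᵀ, d]]`. -/
noncomputable def homog {n : ℕ} (A : Matrix (Fin n) (Fin n) ℝ) (b c : Fin n → ℝ) (d : ℝ)
    (x : Fin n → ℝ) : Fin n → ℝ :=
  (c ⬝ᵥ x + d)⁻¹ • (A.mulVec x + b)

/-- The Jacobian matrix `h'_g(x) = (cᵀx + d)⁻² ((cᵀx + d)A − (Ax + b)cᵀ)`. -/
noncomputable def homogJac {n : ℕ} (A : Matrix (Fin n) (Fin n) ℝ) (b c : Fin n → ℝ) (d : ℝ)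
    (x : Fin n → ℝ) : Matrix (Fin n) (Fin n) ℝ :=
  ((c ⬝ᵥ x + d) ^ 2)⁻¹ • ((c ⬝ᵥ x + d) • A - vecMulVec (A.mulVec x + b) c)

/-- The block matrix `[[A, b], [cᵀ, d]]` of size `(n+1) × (n+1)`. -/
def blockMat {n : ℕ} (A : Matrix (Fin n) (Fin n) ℝ) (b c : Fin n → ℝ) (d : ℝ) :
    Matrix (Fin n ⊕ Unit) (Fin n ⊕ Unit) ℝ :=
  Matrix.fromBlocks A (fun i _ => b i) (fun _ j => c j) (fun _ _ => d)

/-- The transformation `T_g(V)(m) = (cᵀm + d)⁻¹ (h'_g(m))⁻¹ V(h_g(m)) ((h'_g(m))ᵀ)⁻¹`. -/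
noncomputable def Tg {n : ℕ} (A : Matrix (Fin n) (Fin n) ℝ) (b c : Fin n → ℝ) (d : ℝ)
    (V : (Fin n → ℝ) → Matrix (Fin n) (Fin n) ℝ) (m : Fin n → ℝ) :
    Matrix (Fin n) (Fin n) ℝ :=
  (c ⬝ᵥ m + d)⁻¹ •
    ((homogJac A b c d m)⁻¹ * V (homog A b c d m) * ((homogJac A b c d m)ᵀ)⁻¹)

lemma exists_block_inverse {n : ℕ} (A : Matrix (Fin n) (Fin n) ℝ) (b c : Fin n → ℝ) (d : ℝ)
    (hg : (blockMat A b c d).det ≠ 0) :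
    ∃ (A' : Matrix (Fin n) (Fin n) ℝ) (b' c' : Fin n → ℝ) (d' : ℝ),
      A' * A + vecMulVec b' c = 1 ∧ A' *ᵥ b + d • b' = 0 ∧ c' ᵥ* A + d' • c = 0 ∧
      c' ⬝ᵥ b + d' * d = 1 ∧ c ᵥ* A' + d • c' = 0 := by
  have hu : IsUnit (blockMat A b c d).det := isUnit_iff_ne_zero.mpr hg
  have h1 := Matrix.nonsing_inv_mul _ hu
  have h2 := Matrix.mul_nonsing_inv _ hu
  generalize (blockMat A b c d)⁻¹ = g' at h1 h2
  have hB : blockMat A b c d = fromBlocks A (Matrix.of fun i _ => b i) (Matrix.of fun _ j => c j)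
    (Matrix.of fun _ _ => d) := rfl
  rw [← fromBlocks_toBlocks g', hB, fromBlocks_multiply, ← fromBlocks_one,
    fromBlocks_inj] at h1 h2
  obtain ⟨h11, h12, h13, h14⟩ := h1
  obtain ⟨-, -, h23, -⟩ := h2
  refine ⟨g'.toBlocks₁₁, fun i => g'.toBlocks₁₂ i (), fun i => g'.toBlocks₂₁ () i,
    g'.toBlocks₂₂ () (), ?_, ?_, ?_, ?_, ?_⟩
  · rw [← h11]; ext i j; simp [vecMulVec_apply, mul_apply]
  · ext i
    have := congrFun (congrFun h12 i) ()
    simp [mul_apply] at this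
    simp [mulVec, dotProduct]; linarith
  · ext i
    have := congrFun (congrFun h13 ()) i
    simp [mul_apply] at this
    simp [vecMul, dotProduct]; linarith
  · have := congrFun (congrFun h14 ()) ()
    simp [mul_apply] at this
    simp [dotProduct]; linarith
  · ext i
    have := congrFun (congrFun h23 ()) i
    simp [mul_apply] at this
    simp [vecMul, dotProduct]; linarith

lemma K_mul_jac {n : ℕ} (A : Matrix (Fin n) (Fin n) ℝ) (b c : Fin n → ℝ) (d : ℝ)
    (A' : Matrix (Fin n) (Fin n) ℝ) (b' c' : Fin n → ℝ) (d' : ℝ)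
    (h1 : A' * A + vecMulVec b' c = 1) (h2 : A' *ᵥ b + d • b' = 0) (h3 : c' ᵥ* A + d' • c = 0)
    (h4 : c' ⬝ᵥ b + d' * d = 1) (m : Fin n → ℝ) (hs : c ⬝ᵥ m + d ≠ 0) :
    ((c ⬝ᵥ m + d) • (A' - vecMulVec m c')) * homogJac A b c d m = 1 := by
  have e1 : A' * A = 1 - vecMulVec b' c := eq_sub_of_add_eq h1
  have e2 : A' *ᵥ b = - (d • b') := eq_neg_of_add_eq_zero_left h2
  have e3 : c' ᵥ* A = - (d' • c) := eq_neg_of_add_eq_zero_left h3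
  have e4 : c' ⬝ᵥ b = 1 - d' * d := by linarith
  have e5 : A' *ᵥ (A *ᵥ m + b) = m - (c ⬝ᵥ m + d) • b' := by
    rw [mulVec_add, mulVec_mulVec, e1, e2, sub_mulVec, one_mulVec, vecMulVec_mulVec]
    ext i; simp; ring
  have e6 : c' ⬝ᵥ (A *ᵥ m + b) = 1 - (c ⬝ᵥ m + d) * d' := by
    rw [dotProduct_add, dotProduct_mulVec, e3, e4]
    simp; ring
  unfold homogJac
  rw [Matrix.smul_mul, Matrix.mul_smul, Matrix.mul_sub, Matrix.sub_mul, Matrix.mul_smul,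
    Matrix.mul_smul, e1, mul_vecMulVec, sub_mulVec, e5, vecMulVec_mulVec, vecMulVec_mul, e3, e6]
  generalize c ⬝ᵥ m + d = s at *
  ext i j
  simp [vecMulVec_apply]
  field_simp
  ring

lemma hasDerivAt_matrix {n : ℕ} {F : ℝ → Matrix (Fin n) (Fin n) ℝ}
    {F' : Matrix (Fin n) (Fin n) ℝ} {t : ℝ} :
    HasDerivAt F F' t ↔ ∀ i j, HasDerivAt (fun x => F x i j) (F' i j) t := by
  refine hasDerivAt_pi.trans (forall_congr' fun i => hasDerivAt_pi)

lemma hasDerivAt_matmul {n : ℕ} {F G : ℝ → Matrix (Fin n) (Fin n) ℝ}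
    {F' G' : Matrix (Fin n) (Fin n) ℝ} {t : ℝ} (hF : HasDerivAt F F' t) (hG : HasDerivAt G G' t) :
    HasDerivAt (fun x => F x * G x) (F' * G t + F t * G') t := by
  rw [hasDerivAt_matrix] at *
  intro i j
  simp only [mul_apply, Matrix.add_apply, ← Finset.sum_add_distrib]
  exact HasDerivAt.fun_sum fun k _ => (hF i k).mul (hG k j)

lemma contDiffOn_matrix {n : ℕ} {F : (Fin n → ℝ) → Matrix (Fin n) (Fin n) ℝ}
    {U : Set (Fin n → ℝ)} :
    ContDiffOn ℝ 1 F U ↔ ∀ i j, ContDiffOn ℝ 1 (fun x => F x i j) U := by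
  refine contDiffOn_pi.trans (forall_congr' fun i => contDiffOn_pi)

lemma contDiffOn_matmul {n : ℕ} {F G : (Fin n → ℝ) → Matrix (Fin n) (Fin n) ℝ}
    {U : Set (Fin n → ℝ)} (hF : ContDiffOn ℝ 1 F U) (hG : ContDiffOn ℝ 1 G U) :
    ContDiffOn ℝ 1 (fun x => F x * G x) U := by
  rw [contDiffOn_matrix] at *
  intro i j
  simp only [mul_apply]
  exact ContDiffOn.sum fun k _ => (hF i k).mul (hG k j)

lemma contDiff_dot {n : ℕ} (c : Fin n → ℝ) : ContDiff ℝ 1 (fun m : Fin n → ℝ => c ⬝ᵥ m) := by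
  unfold dotProduct
  fun_prop

lemma contDiffOn_homog {n : ℕ} (A : Matrix (Fin n) (Fin n) ℝ) (b c : Fin n → ℝ) (d : ℝ)
    (U : Set (Fin n → ℝ)) (hU : ∀ m ∈ U, c ⬝ᵥ m + d ≠ 0) :
    ContDiffOn ℝ 1 (homog A b c d) U := by
  unfold homog
  rw [contDiffOn_pi]
  intro i
  simp only [Pi.smul_apply, Pi.add_apply, mulVec, smul_eq_mul]
  refine ContDiffOn.mul (ContDiffOn.inv ?_ hU) ?_
  · exact ((contDiff_dot c).add contDiff_const).contDiffOn
  · exact ((contDiff_dot (A i)).add contDiff_const).contDiffOn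

lemma hasDerivAt_line {n : ℕ} (m u : Fin n → ℝ) :
    HasDerivAt (fun t : ℝ => m + t • u) u 0 := by
  simpa using ((hasDerivAt_id (0 : ℝ)).smul_const u).const_add m

lemma hasDerivAt_dot {n : ℕ} (c m u : Fin n → ℝ) (d : ℝ) :
    HasDerivAt (fun t : ℝ => c ⬝ᵥ (m + t • u) + d) (c ⬝ᵥ u) 0 := by
  simp only [dotProduct_add, dotProduct_smul, smul_eq_mul]
  simpa using (((hasDerivAt_id (0 : ℝ)).mul_const (c ⬝ᵥ u)).const_add (c ⬝ᵥ m)).add_const d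

lemma hasDerivAt_homog {n : ℕ} (A : Matrix (Fin n) (Fin n) ℝ) (b c : Fin n → ℝ) (d : ℝ)
    (m u : Fin n → ℝ) (hs : c ⬝ᵥ m + d ≠ 0) :
    HasDerivAt (fun t : ℝ => homog A b c d (m + t • u)) (homogJac A b c d m *ᵥ u) 0 := by
  rw [hasDerivAt_pi]
  intro i
  have h1 := hasDerivAt_dot c m u d
  have h2 := hasDerivAt_dot (A i) m u (b i)
  have h3 := (h1.inv (by simpa using hs)).mul h2
  refine h3.congr_deriv ?_
  simp only [homogJac, smul_mulVec, sub_mulVec, vecMulVec_mulVec]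
  simp [mulVec]
  field_simp
  ring

lemma hasDerivAt_K {n : ℕ} (A' : Matrix (Fin n) (Fin n) ℝ) (c' m u : Fin n → ℝ) :
    HasDerivAt (fun t : ℝ => A' - vecMulVec (m + t • u) c') (- vecMulVec u c') 0 := by
  rw [hasDerivAt_matrix]
  intro i j
  have := ((((hasDerivAt_id (0 : ℝ)).mul_const (u i)).const_add (m i)).mul_const (c' j)).const_sub
    (A' i j)
  simpa [vecMulVec_apply] using this

lemma hasDerivAt_Kt {n : ℕ} (A' : Matrix (Fin n) (Fin n) ℝ) (c' m u : Fin n → ℝ) :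
    HasDerivAt (fun t : ℝ => (A' - vecMulVec (m + t • u) c')ᵀ) (- vecMulVec c' u) 0 := by
  rw [hasDerivAt_matrix]
  intro i j
  have := hasDerivAt_matrix.1 (hasDerivAt_K A' c' m u) j i
  simpa [vecMulVec_apply, mul_comm] using this

lemma contDiff_K {n : ℕ} (A' : Matrix (Fin n) (Fin n) ℝ) (c' : Fin n → ℝ)
    (U : Set (Fin n → ℝ)) :
    ContDiffOn ℝ 1 (fun m => A' - vecMulVec m c') U ∧
    ContDiffOn ℝ 1 (fun m => (A' - vecMulVec m c')ᵀ) U := by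
  constructor
  all_goals
    rw [contDiffOn_matrix]
    intro i j
    simp only [transpose_apply, Matrix.sub_apply, vecMulVec_apply]
    fun_prop

/-- **Proposition 3.4, part 2.** The class of `C¹` maps into invertible symmetric matrices
satisfying the directional-derivative symmetry condition is stable under `T_g`. -/
theorem Tg_preserves_symmetry_condition {n : ℕ} (hn : 1 ≤ n)
    (M : Set (Fin n → ℝ)) (hM : IsOpen M)
    (V : (Fin n → ℝ) → Matrix (Fin n) (Fin n) ℝ)
    (hV : ContDiffOn ℝ 1 V M)
    (hVinv : ∀ m ∈ M, IsUnit (V m))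
    (hVsymm : ∀ m ∈ M, (V m).IsSymm)
    (hVcond : ∀ m ∈ M, ∀ Δ Δ₁ : Fin n → ℝ,
      (fderiv ℝ V m ((V m).mulVec Δ)).mulVec Δ₁
        = (fderiv ℝ V m ((V m).mulVec Δ₁)).mulVec Δ)
    (A : Matrix (Fin n) (Fin n) ℝ) (b c : Fin n → ℝ) (d : ℝ)
    (hg : (blockMat A b c d).det ≠ 0)
    (U : Set (Fin n → ℝ)) (hU : IsOpen U)
    (hUpos : ∀ m ∈ U, 0 < c ⬝ᵥ m + d)
    (hUmap : ∀ m ∈ U, homog A b c d m ∈ M) :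
    (∀ m ∈ U, IsUnit (Tg A b c d V m)) ∧
    (∀ m ∈ U, (Tg A b c d V m).IsSymm) ∧
    ContDiffOn ℝ 1 (Tg A b c d V) U ∧
    (∀ m ∈ U, ∀ Δ Δ₁ : Fin n → ℝ,
      (fderiv ℝ (Tg A b c d V) m ((Tg A b c d V m).mulVec Δ)).mulVec Δ₁
        = (fderiv ℝ (Tg A b c d V) m ((Tg A b c d V m).mulVec Δ₁)).mulVec Δ) := by
  obtain ⟨A', b', c', d', h1, h2, h3, h4, h5⟩ := exists_block_inverse A b c d hg
  have hne : ∀ m ∈ U, c ⬝ᵥ m + d ≠ 0 := fun m hm => (hUpos m hm).ne'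
  have hKJ : ∀ m ∈ U, ((c ⬝ᵥ m + d) • (A' - vecMulVec m c')) * homogJac A b c d m = 1 :=
    fun m hm => K_mul_jac A b c d A' b' c' d' h1 h2 h3 h4 m (hne m hm)
  set W : (Fin n → ℝ) → Matrix (Fin n) (Fin n) ℝ := fun m => (c ⬝ᵥ m + d) •
    ((A' - vecMulVec m c') * V (homog A b c d m) * (A' - vecMulVec m c')ᵀ) with hW
  have hTW : ∀ m ∈ U, Tg A b c d V m = W m := by
    intro m hm
    have hs := hne m hm
    rw [Tg, ← transpose_nonsing_inv, Matrix.inv_eq_left_inv (hKJ m hm), hW]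
    simp only [transpose_smul, Matrix.smul_mul, Matrix.mul_smul, smul_smul]
    congr 1
    field_simp
  have hKu : ∀ m ∈ U, IsUnit (A' - vecMulVec m c') := by
    intro m hm
    have := hKJ m hm
    rw [Matrix.smul_mul, ← Matrix.mul_smul] at this
    exact IsUnit.of_mul_eq_one _ this
  have hWsymm : ∀ m ∈ U, (W m).IsSymm := by
    intro m hm
    have := hVsymm _ (hUmap m hm)
    simp only [hW, Matrix.IsSymm, transpose_smul, transpose_mul, transpose_transpose, this.eq,
      Matrix.mul_assoc]
  have hWC : ContDiffOn ℝ 1 W U := by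
    have hs : ContDiffOn ℝ 1 (fun m : Fin n → ℝ => c ⬝ᵥ m + d) U :=
      ((contDiff_dot c).add contDiff_const).contDiffOn
    have hVh : ContDiffOn ℝ 1 (fun m => V (homog A b c d m)) U :=
      hV.comp (contDiffOn_homog A b c d U hne) hUmap
    exact hs.smul (contDiffOn_matmul (contDiffOn_matmul (contDiff_K A' c' U).1 hVh)
      (contDiff_K A' c' U).2)
  have hTC : ContDiffOn ℝ 1 (Tg A b c d V) U := hWC.congr hTW
  refine ⟨fun m hm => ?_, fun m hm => ?_, hTC, fun m hm Δ Δ₁ => ?_⟩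
  · rw [hTW m hm]
    have hu := ((hKu m hm).mul (hVinv _ (hUmap m hm))).mul
      ((Matrix.isUnit_transpose _).2 (hKu m hm))
    exact hu.smul (Units.mk0 _ (hne m hm))
  · rw [hTW m hm]; exact hWsymm m hm
  · have hev : Tg A b c d V =ᶠ[nhds m] W := by
      filter_upwards [hU.mem_nhds hm] with x hx using hTW x hx
    rw [hev.fderiv_eq, hTW m hm]
    have hs := hne m hm
    have hsy := hWsymm m hm
    have hWd : HasFDerivAt W (fderiv ℝ W m) m :=
      ((hWC.contDiffAt (hU.mem_nhds hm)).differentiableAt (by norm_num)).hasFDerivAt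
    have hy := hUmap m hm
    have hVd : HasFDerivAt V (fderiv ℝ V (homog A b c d m)) (homog A b c d m) :=
      ((hV.contDiffAt (hM.mem_nhds hy)).differentiableAt (by norm_num)).hasFDerivAt
    have hcond := hVcond _ hy
    set K := A' - vecMulVec m c' with hK
    set Y := V (homog A b c d m) with hY
    set L := fderiv ℝ V (homog A b c d m) with hL
    set J := homogJac A b c d m with hJ
    have hWm : W m = (c ⬝ᵥ m + d) • (K * Y * Kᵀ) := rfl
    have key : ∀ u, fderiv ℝ W m u = (c ⬝ᵥ u) • (K * Y * Kᵀ) + (c ⬝ᵥ m + d) •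
        ((-vecMulVec u c' * Y + K * L (J *ᵥ u)) * Kᵀ + K * Y * (-vecMulVec c' u)) := by
      intro u
      have e1 : HasDerivAt (fun t : ℝ => W (m + t • u)) (fderiv ℝ W m u) 0 :=
        HasFDerivAt.comp_hasDerivAt_of_eq (0 : ℝ) hWd (hasDerivAt_line m u) (by simp)
      have e2 : HasDerivAt (fun t : ℝ => V (homog A b c d (m + t • u))) (L (J *ᵥ u)) 0 :=
        HasFDerivAt.comp_hasDerivAt_of_eq (0 : ℝ) hVd (hasDerivAt_homog A b c d m u hs) (by simp)
      have e3 := (hasDerivAt_dot c m u d).smul (hasDerivAt_matmul (hasDerivAt_matmul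
        (hasDerivAt_K A' c' m u) e2) (hasDerivAt_Kt A' c' m u))
      refine e1.unique (e3.congr_deriv ?_)
      simp only [zero_smul, add_zero]
      rw [add_comm]
    have hJK : J * ((c ⬝ᵥ m + d) • K) = 1 := mul_eq_one_comm.1 (hKJ m hm)
    have hJW : ∀ v, J *ᵥ (W m *ᵥ v) = Y *ᵥ (Kᵀ *ᵥ v) := by
      intro v
      rw [hWm, mulVec_mulVec, mulVec_mulVec]
      congr 1
      rw [Matrix.mul_assoc, ← Matrix.smul_mul, ← Matrix.mul_assoc, hJK, Matrix.one_mul]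
    have hc : Kᵀ *ᵥ c = -((c ⬝ᵥ m + d) • c') := by
      have : c ᵥ* A' = -(d • c') := eq_neg_of_add_eq_zero_left h5
      rw [mulVec_transpose, hK, vecMul_sub, this, vecMul_vecMulVec]
      ext i; simp; ring
    have hcW : ∀ v, c ⬝ᵥ (W m *ᵥ v) = -((c ⬝ᵥ m + d)^2 * (c' ⬝ᵥ (Y *ᵥ (Kᵀ *ᵥ v)))) := by
      intro v
      rw [hWm, smul_mulVec, dotProduct_smul, Matrix.mul_assoc, ← mulVec_mulVec, ← mulVec_mulVec,
        dotProduct_mulVec, ← mulVec_transpose, hc]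
      simp; ring
    have hsymdot : (W m *ᵥ Δ) ⬝ᵥ Δ₁ = (W m *ᵥ Δ₁) ⬝ᵥ Δ := by
      rw [dotProduct_comm, dotProduct_mulVec, ← mulVec_transpose, hsy.eq]
    clear_value W K Y L J
    have full : ∀ a e, fderiv ℝ W m (W m *ᵥ a) *ᵥ e =
        (c ⬝ᵥ (W m *ᵥ a)) • ((c ⬝ᵥ m + d)⁻¹ • (W m *ᵥ e))
        + (c ⬝ᵥ (W m *ᵥ e)) • ((c ⬝ᵥ m + d)⁻¹ • (W m *ᵥ a))
        + (c ⬝ᵥ m + d) • (K *ᵥ (L (Y *ᵥ (Kᵀ *ᵥ a)) *ᵥ (Kᵀ *ᵥ e)))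
        - ((c ⬝ᵥ m + d) * ((W m *ᵥ a) ⬝ᵥ e)) • (K *ᵥ (Y *ᵥ c')) := by
      intro a e
      have e1 : (K * Y * Kᵀ) *ᵥ e = (c ⬝ᵥ m + d)⁻¹ • (W m *ᵥ e) := by
        rw [hWm, smul_mulVec, smul_smul, inv_mul_cancel₀ hs, one_smul]
      rw [key, hJW, hcW e]
      generalize W m *ᵥ a = wa
      rw [add_mulVec, smul_mulVec, e1, smul_mulVec, add_mulVec]
      simp only [← mulVec_mulVec, add_mulVec, neg_mulVec, vecMulVec_mulVec, mulVec_neg,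
        Matrix.add_mul, mulVec_smul]
      ext i
      simp
      field_simp
      ring
    rw [full, full, hsymdot, hcond (Kᵀ *ᵥ Δ) (Kᵀ *ᵥ Δ₁)]
    abel
end

section
/- (Core identity of Proposition 7.1.) Let n ≥ 1 and let f : (0,∞) × ℝⁿ → [0,∞) be measurable such that: (i) for all λ, s > 0 and almost every x ∈ ℝⁿ, f(λ+s, x) = ∫_{ℝⁿ} f(λ, y) f(s, x−y) dy (convolution semigroup of densities); and (ii) there exist an open neighborhood W of 0 in ℝⁿ and a function L : W → (0,∞) such that for every θ ∈ W and λ > 0, ∫_{ℝⁿ} e^{⟨θ,x⟩} f(λ, x) dx = L(θ)^λ < ∞. Let c ∈ ℝⁿ. Then for all λ, s > 0 and Lebesgue-almost every x ∈ ℝⁿ: (λ/(λ+s)) · ⟨c,x⟩ · f(λ+s, x) = ∫_{ℝⁿ} ⟨c,y⟩ f(λ, y) f(s, x−y) dy. -/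
open Matrix MeasureTheory

lemma additive_pos_linear (h : ℝ → ℂ) (hm : Measurable h)
    (hadd : ∀ a > 0, ∀ b > 0, h (a + b) = h a + h b) :
    ∀ a > 0, h a = (a : ℂ) * h 1 := by
  let H : ℝ →+ ℂ := AddMonoidHom.mk' (fun x => h (|x| + 1 + x) - h (|x| + 1)) (by
    intro x y
    have px : 0 < |x| + 1 + x := by linarith [neg_abs_le x]
    have py : 0 < |y| + 1 + y := by linarith [neg_abs_le y]
    have pxy : 0 < |x + y| + 1 + (x + y) := by linarith [neg_abs_le (x + y)]
    have qx : 0 < |x| + 1 := by positivity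
    have qy : 0 < |y| + 1 := by positivity
    have qxy : 0 < |x + y| + 1 := by positivity
    have e1 := hadd _ (add_pos px py) _ qxy
    rw [hadd _ px _ py] at e1
    have e2 := hadd _ (add_pos qx qy) _ pxy
    rw [hadd _ qx _ qy] at e2
    have e3 : |x| + 1 + x + (|y| + 1 + y) + (|x + y| + 1)
        = |x| + 1 + (|y| + 1) + (|x + y| + 1 + (x + y)) := by ring
    rw [e3, e2] at e1
    linear_combination e1)
  have hH : ∀ x, H x = h (|x| + 1 + x) - h (|x| + 1) := fun x => rfl
  have hHm : Measurable H := by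
    change Measurable (fun x => h (|x| + 1 + x) - h (|x| + 1))
    have m1 : Measurable (fun x : ℝ => |x| + 1) := by fun_prop
    have m2 : Measurable (fun x : ℝ => |x| + 1 + x) := by fun_prop
    exact (hm.comp m2).sub (hm.comp m1)
  have hc : Continuous H := MeasureTheory.Measure.AddMonoidHom.continuous_of_measurable H hHm
  have hpos : ∀ a > 0, H a = h a := by
    intro a ha
    rw [hH, hadd _ (by positivity) _ ha]
    ring
  intro a ha
  have := map_real_smul H hc a 1
  rw [smul_eq_mul, mul_one, hpos a ha, hpos 1 one_pos] at this
  rw [this]; simp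

lemma semigroup_identity (φ D : ℝ → ℂ) (hφm : Measurable φ) (hDm : Measurable D)
    (hφ : ∀ a > 0, ∀ b > 0, φ (a + b) = φ a * φ b)
    (hD : ∀ a > 0, ∀ b > 0, D (a + b) = D a * φ b + φ a * D b) :
    ∀ a > 0, ∀ b > 0, D a * φ b = ((a / (a + b) : ℝ) : ℂ) * D (a + b) := by
  intro a ha b hb
  by_cases hz : ∃ t > 0, φ t = 0
  · obtain ⟨t, ht, hzt⟩ := hz
    have h1 : ∀ k : ℕ, φ (t * (1 / 2) ^ k) = 0 := by
      intro k
      induction k with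
      | zero => simpa using hzt
      | succ k ih =>
        have hp : 0 < t * (1 / 2 : ℝ) ^ (k + 1) := by positivity
        have := hφ _ hp _ hp
        rw [show t * (1 / 2 : ℝ) ^ (k + 1) + t * (1 / 2 : ℝ) ^ (k + 1) = t * (1 / 2) ^ k by ring,
          ih] at this
        exact mul_self_eq_zero.mp this.symm
    have h2 : ∀ u > 0, φ u = 0 := by
      intro u hu
      obtain ⟨k, hk⟩ := exists_pow_lt_of_lt_one (div_pos hu ht) (by norm_num : (1 / 2 : ℝ) < 1)
      rw [lt_div_iff₀ ht] at hk
      have := hφ (t * (1 / 2) ^ k) (by positivity) (u - t * (1 / 2) ^ k) (by linarith)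
      rw [h1 k] at this
      simpa using this
    rw [hD a ha b hb, h2 a ha, h2 b hb]; simp
  · push Not at hz
    have hl := additive_pos_linear (fun x => D x / φ x) (hDm.div hφm) (by
      intro a ha b hb
      have := hz a ha
      have := hz b hb
      simp only [hφ a ha b hb, hD a ha b hb]
      field_simp)
    have hl' : ∀ a > 0, D a = a * (D 1 / φ 1) * φ a := by
      intro a ha
      rw [← hl a ha]
      have := hz a ha
      field_simp
    have hab : (a : ℂ) + b ≠ 0 := by exact_mod_cast (add_pos ha hb).ne'
    rw [hl' a ha, hl' (a + b) (add_pos ha hb), hφ a ha b hb]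
    push_cast
    field_simp

section
variable {n : ℕ}

noncomputable def FT (l : StrongDual ℝ (Fin n → ℝ)) (g : (Fin n → ℝ) → ℝ) : ℂ :=
  ∫ x, Complex.exp (l x * Complex.I) * (g x : ℂ)

lemma FT_integrable (l : StrongDual ℝ (Fin n → ℝ)) {g : (Fin n → ℝ) → ℝ} (hg : Integrable g) :
    Integrable (fun x => Complex.exp (l x * Complex.I) * (g x : ℂ)) := by
  refine hg.ofReal.bdd_mul (c := 1) ?_ ?_
  · exact Continuous.aestronglyMeasurable (by fun_prop)
  · exact Filter.Eventually.of_forall fun x => (Complex.norm_exp_ofReal_mul_I _).le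

open scoped Convolution in
lemma FT_conv (l : StrongDual ℝ (Fin n → ℝ)) {g h : (Fin n → ℝ) → ℝ}
    (hg : Integrable g) (hh : Integrable h) :
    FT l (fun x => ∫ y, g y * h (x - y)) = FT l g * FT l h := by
  have := integral_convolution (ContinuousLinearMap.mul ℝ ℂ)
    (FT_integrable l hg) (FT_integrable l hh)
  rw [ContinuousLinearMap.mul_apply'] at this
  unfold FT
  rw [← this]
  congr 1
  ext x
  rw [convolution_def, ← integral_complex_ofReal, ← integral_const_mul]
  congr 1
  ext y
  rw [ContinuousLinearMap.mul_apply', map_sub]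
  rw [show ((l x : ℂ)) * Complex.I = l y * Complex.I + ((l x - l y : ℝ) : ℂ) * Complex.I by
    push_cast; ring, Complex.exp_add]
  push_cast
  ring

lemma conv_integrable {g h : (Fin n → ℝ) → ℝ} (hg : Integrable g) (hh : Integrable h) :
    Integrable (fun x => ∫ y, g y * h (x - y)) :=
  hg.integrable_convolution (ContinuousLinearMap.mul ℝ ℝ) hh

lemma conv_exists {g h : (Fin n → ℝ) → ℝ} (hg : Integrable g) (hh : Integrable h) :
    ∀ᵐ x, Integrable (fun y => g y * h (x - y)) :=
  hg.ae_convolution_exists (ContinuousLinearMap.mul ℝ ℝ) hh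

lemma charFunDual_dens (l : StrongDual ℝ (Fin n → ℝ)) {g : (Fin n → ℝ) → ℝ} (hg : Integrable g)
    (hg0 : ∀ x, 0 ≤ g x) :
    charFunDual (volume.withDensity fun x => ENNReal.ofReal (g x)) l = FT l g := by
  rw [charFunDual_apply, integral_withDensity_eq_integral_toReal_smul₀
    hg.aestronglyMeasurable.aemeasurable.ennreal_ofReal (by simp)]
  unfold FT
  congr 1
  ext x
  rw [ENNReal.toReal_ofReal (hg0 x), Complex.real_smul, mul_comm]

lemma FT_inj_nonneg {g h : (Fin n → ℝ) → ℝ} (hg : Integrable g) (hh : Integrable h)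
    (hg0 : ∀ x, 0 ≤ g x) (hh0 : ∀ x, 0 ≤ h x) (H : ∀ l, FT l g = FT l h) : g =ᵐ[volume] h := by
  have : IsFiniteMeasure (volume.withDensity fun x => ENNReal.ofReal (g x)) :=
    isFiniteMeasure_withDensity_ofReal hg.2
  have : IsFiniteMeasure (volume.withDensity fun x => ENNReal.ofReal (h x)) :=
    isFiniteMeasure_withDensity_ofReal hh.2
  have key := Measure.ext_of_charFunDual
    (μ := volume.withDensity fun x => ENNReal.ofReal (g x))
    (ν := volume.withDensity fun x => ENNReal.ofReal (h x)) (by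
      ext l
      rw [charFunDual_dens l hg hg0, charFunDual_dens l hh hh0, H])
  rw [withDensity_eq_iff_of_sigmaFinite hg.aestronglyMeasurable.aemeasurable.ennreal_ofReal
    hh.aestronglyMeasurable.aemeasurable.ennreal_ofReal] at key
  filter_upwards [key] with x hx
  exact (ENNReal.ofReal_eq_ofReal_iff (hg0 x) (hh0 x)).mp hx

lemma FT_add (l : StrongDual ℝ (Fin n → ℝ)) {g h : (Fin n → ℝ) → ℝ}
    (hg : Integrable g) (hh : Integrable h) :
    FT l (fun x => g x + h x) = FT l g + FT l h := by
  unfold FT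
  rw [← integral_add (FT_integrable l hg) (FT_integrable l hh)]
  congr 1
  ext x
  push_cast
  ring

lemma FT_congr (l : StrongDual ℝ (Fin n → ℝ)) {g h : (Fin n → ℝ) → ℝ}
    (H : g =ᵐ[volume] h) : FT l g = FT l h := by
  apply integral_congr_ae
  filter_upwards [H] with x hx
  rw [hx]

lemma FT_const_mul (l : StrongDual ℝ (Fin n → ℝ)) (r : ℝ) (g : (Fin n → ℝ) → ℝ) :
    FT l (fun x => r * g x) = r * FT l g := by
  unfold FT
  rw [← integral_const_mul]
  congr 1
  ext x
  push_cast
  ring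

lemma FT_inj {g h : (Fin n → ℝ) → ℝ} (hg : Integrable g) (hh : Integrable h)
    (H : ∀ l, FT l g = FT l h) : g =ᵐ[volume] h := by
  -- add `|g| + |h|` to both sides
  have hG : Integrable (fun x => |g x| + |h x|) := hg.abs.add hh.abs
  have := FT_inj_nonneg (g := fun x => g x + (|g x| + |h x|)) (h := fun x => h x + (|g x| + |h x|))
    (hg.add hG) (hh.add hG)
    (fun x => by linarith [neg_abs_le (g x), abs_nonneg (h x)])
    (fun x => by linarith [neg_abs_le (h x), abs_nonneg (g x)])
    (fun l => by rw [FT_add l hg hG, FT_add l hh hG, H])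
  filter_upwards [this] with x hx
  linarith

lemma FT_measurable (l : StrongDual ℝ (Fin n → ℝ)) {f : ℝ → (Fin n → ℝ) → ℝ}
    (hf : Measurable (Function.uncurry f)) : Measurable (fun a => FT l (f a)) := by
  have : StronglyMeasurable (fun p : ℝ × (Fin n → ℝ) =>
      Complex.exp (l p.2 * Complex.I) * ((f p.1 p.2 : ℝ) : ℂ)) := by
    apply Measurable.stronglyMeasurable
    have h1 : Measurable (fun p : ℝ × (Fin n → ℝ) => f p.1 p.2) := hf
    have h2 : Measurable (fun p : ℝ × (Fin n → ℝ) => l p.2) :=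
      Continuous.measurable (by fun_prop)
    fun_prop
  exact this.integral_prod_right'.measurable

end

/-- **Core identity of Proposition 7.1.** If `(f(λ,·))_{λ>0}` is a convolution semigroup of
densities on `ℝⁿ` whose Laplace transforms satisfy `∫ e^{⟨θ,x⟩} f(λ,x) dx = L(θ)^λ` on a
neighborhood `W` of `0`, then for all `λ, s > 0` and almost every `x`:
`(λ/(λ+s)) ⟨c,x⟩ f(λ+s, x) = ∫ ⟨c,y⟩ f(λ,y) f(s,x−y) dy`. -/
theorem rouques_identity {n : ℕ} (hn : 1 ≤ n)
    (f : ℝ → (Fin n → ℝ) → ℝ)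
    (hf_nonneg : ∀ lam x, 0 ≤ f lam x)
    (hf_meas : Measurable (Function.uncurry f))
    (hconv : ∀ lam > (0 : ℝ), ∀ s > (0 : ℝ),
      ∀ᵐ x ∂(volume : Measure (Fin n → ℝ)),
        f (lam + s) x = ∫ y, f lam y * f s (x - y))
    (W : Set (Fin n → ℝ)) (hW : IsOpen W) (h0W : (0 : Fin n → ℝ) ∈ W)
    (L : (Fin n → ℝ) → ℝ) (hL : ∀ θ ∈ W, 0 < L θ)
    (hLap : ∀ θ ∈ W, ∀ lam > (0 : ℝ),
      Integrable (fun x => Real.exp (θ ⬝ᵥ x) * f lam x) ∧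
      ∫ x, Real.exp (θ ⬝ᵥ x) * f lam x = L θ ^ lam)
    (c : Fin n → ℝ) :
    ∀ lam > (0 : ℝ), ∀ s > (0 : ℝ),
      ∀ᵐ x ∂(volume : Measure (Fin n → ℝ)),
        (lam / (lam + s)) * (c ⬝ᵥ x) * f (lam + s) x
          = ∫ y, (c ⬝ᵥ y) * f lam y * f s (x - y) := by
  have hfi : ∀ a > 0, Integrable (f a) := by
    intro a ha
    simpa using (hLap 0 h0W a ha).1
  have hdot : Measurable (fun x : Fin n → ℝ => c ⬝ᵥ x) := by
    apply Continuous.measurable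
    unfold dotProduct
    fun_prop
  have hAm : Measurable (Function.uncurry fun a x => (c ⬝ᵥ x) * f a x) :=
    (hdot.comp measurable_snd).mul hf_meas
  obtain ⟨ε, hε, hp, hm⟩ : ∃ ε > (0 : ℝ), ε • c ∈ W ∧ (-ε) • c ∈ W := by
    have hc : Continuous (fun t : ℝ => t • c) := by fun_prop
    have hc' : Continuous (fun t : ℝ => (-t) • c) := by fun_prop
    have h1 : ∀ᶠ t in nhds (0 : ℝ), t • c ∈ W :=
      hc.continuousAt.eventually_mem (hW.mem_nhds (by simpa using h0W))
    have h2 : ∀ᶠ t in nhds (0 : ℝ), (-t) • c ∈ W :=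
      hc'.continuousAt.eventually_mem (hW.mem_nhds (by simpa using h0W))
    obtain ⟨r, hr, h⟩ := Metric.eventually_nhds_iff.mp (h1.and h2)
    refine ⟨r / 2, by positivity, h ?_⟩
    simp [abs_of_pos hr, hr]
  have hAi : ∀ a > 0, Integrable (fun x => (c ⬝ᵥ x) * f a x) := by
    intro a ha
    have hi := (((hLap _ hp a ha).1.add (hLap _ hm a ha).1).const_mul (1 / ε))
    refine hi.mono' ((hAm.comp (measurable_prodMk_left (x := a))).aestronglyMeasurable) ?_
    refine Filter.Eventually.of_forall fun x => ?_
    simp only [Pi.add_apply, smul_dotProduct, smul_eq_mul]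
    rw [norm_mul, Real.norm_eq_abs, Real.norm_eq_abs, abs_of_nonneg (hf_nonneg a x), ← add_mul,
      ← mul_assoc]
    apply mul_le_mul_of_nonneg_right _ (hf_nonneg a x)
    rw [one_div, inv_mul_eq_div, le_div_iff₀ hε]
    have e1 := Real.add_one_le_exp (ε * (c ⬝ᵥ x))
    have e2 := Real.add_one_le_exp (-ε * (c ⬝ᵥ x))
    have e3 := Real.exp_pos (ε * (c ⬝ᵥ x))
    have e4 := Real.exp_pos (-ε * (c ⬝ᵥ x))
    rcases abs_cases (c ⬝ᵥ x) with ⟨h, _⟩ | ⟨h, _⟩ <;> rw [h] <;> nlinarith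
  have key : ∀ l : StrongDual ℝ (Fin n → ℝ), ∀ a > 0, ∀ b > 0,
      FT l (fun x => (c ⬝ᵥ x) * f a x) * FT l (f b)
        = ((a / (a + b) : ℝ) : ℂ) * FT l (fun x => (c ⬝ᵥ x) * f (a + b) x) := by
    intro l
    apply semigroup_identity (fun a => FT l (f a)) (fun a => FT l (fun x => (c ⬝ᵥ x) * f a x))
      (FT_measurable l hf_meas) (FT_measurable l hAm)
    · intro a ha b hb
      exact (FT_congr l (hconv a ha b hb)).trans (FT_conv l (hfi a ha) (hfi b hb))
    · intro a ha b hb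
      rw [← FT_conv l (hAi a ha) (hfi b hb), ← FT_conv l (hfi a ha) (hAi b hb),
        ← FT_add l (conv_integrable (hAi a ha) (hfi b hb)) (conv_integrable (hfi a ha) (hAi b hb))]
      apply FT_congr
      filter_upwards [hconv a ha b hb, conv_exists (hAi a ha) (hfi b hb),
        conv_exists (hfi a ha) (hAi b hb)] with x hx h1 h2
      rw [hx, ← integral_add h1 h2, ← integral_const_mul]
      congr 1
      ext y
      rw [dotProduct_sub]
      ring
  intro a ha b hb
  have := FT_inj ((hAi (a + b) (add_pos ha hb)).const_mul (a / (a + b)))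
    (conv_integrable (hAi a ha) (hfi b hb)) (fun l => by
      rw [FT_const_mul, FT_conv l (hAi a ha) (hfi b hb), key l a ha b hb])
  filter_upwards [this] with x hx
  rw [← hx]
  ring
end
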